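/- Let (T,N,S) be an ON-structure on an anti-flexible algebra (A,·) with respect to a bimodule (M,l,r). Then N∘T : M → A is a Rota–Baxter operator on (A,·) with respect to (M,l,r), i.e. (N∘T)(m)·(N∘T)(n) = (N∘T)(l((N∘T)(m))n + r((N∘T)(n))m) for all m, n ∈ M. -/

import Mathlib

/-- The anti-flexible identity for a (bilinear) product. -/
def AntiFlexible {A : Type*} [AddCommGroup A] (mul : A → A → A) : Prop :=
  ∀ a b c : A, mul (mul a b) c - mul a (mul b c) = mul (mul c b) a - mul c (mul b a)

/-- The bimodule equations for `(M, l, r)` over `(A, mul)`. -/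
def IsBimodule {K A M : Type*} [Field K] [AddCommGroup A] [Module K A]
    [AddCommGroup M] [Module K M]
    (mul : A →ₗ[K] A →ₗ[K] A) (l r : A →ₗ[K] Module.End K M) : Prop :=
  (∀ a b : A, l (mul a b) - l a * l b = r a * r b - r (mul b a)) ∧
  (∀ a b : A, l a * r b - r b * l a = l b * r a - r a * l b)

/-- Rota–Baxter operator `T : M → A`. -/
def IsRotaBaxter {K A M : Type*} [Field K] [AddCommGroup A] [Module K A]
    [AddCommGroup M] [Module K M]
    (mul : A →ₗ[K] A →ₗ[K] A) (l r : A →ₗ[K] Module.End K M) (T : M →ₗ[K] A) : Prop :=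
  ∀ m n : M, mul (T m) (T n) = T (l (T m) n + r (T n) m)

/-- Nijenhuis operator on `(A, mul)`. -/
def IsNijenhuis {A : Type*} [AddCommGroup A] (mul : A → A → A) (N : A → A) : Prop :=
  ∀ a b : A, mul (N a) (N b) = N (mul (N a) b + mul a (N b) - N (mul a b))

/-- A Nijenhuis structure `(N, S)` on the `A`-bimodule `M`. -/
def IsNijenhuisStructure {K A M : Type*} [Field K] [AddCommGroup A] [Module K A]
    [AddCommGroup M] [Module K M]
    (mul : A →ₗ[K] A →ₗ[K] A) (l r : A →ₗ[K] Module.End K M)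
    (N : Module.End K A) (S : Module.End K M) : Prop :=
  IsNijenhuis (fun a b => mul a b) N ∧
  (∀ (a : A) (m : M),
    l (N a) (S m) = S (l (N a) m) + l a (S (S m)) - S (l a (S m))) ∧
  (∀ (a : A) (m : M),
    r (N a) (S m) = S (r (N a) m) + r a (S (S m)) - S (r a (S m)))

/-- The product `m ⋆_Q n = l(Q m)n + r(Q n)m` on `M` induced by a map `Q : M → A`. -/
def starQ {K A M : Type*} [Field K] [AddCommGroup A] [Module K A]
    [AddCommGroup M] [Module K M]
    (l r : A →ₗ[K] Module.End K M) (Q : M → A) : M → M → M :=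
  fun m n => l (Q m) n + r (Q n) m

/-- The product `m ⋆^S_T n = S(m) ⋆_T n + m ⋆_T S(n) − S(m ⋆_T n)`. -/
def starST {K A M : Type*} [Field K] [AddCommGroup A] [Module K A]
    [AddCommGroup M] [Module K M]
    (l r : A →ₗ[K] Module.End K M) (T : M →ₗ[K] A) (S : Module.End K M) : M → M → M :=
  fun m n => starQ l r (⇑T) (S m) n + starQ l r (⇑T) m (S n) - S (starQ l r (⇑T) m n)

/-- An `ON`-structure `(T, N, S)` on the anti-flexible algebra `(A, mul)` with respect to
the bimodule `(M, l, r)`. -/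
def IsONStructure {K A M : Type*} [Field K] [AddCommGroup A] [Module K A]
    [AddCommGroup M] [Module K M]
    (mul : A →ₗ[K] A →ₗ[K] A) (l r : A →ₗ[K] Module.End K M)
    (T : M →ₗ[K] A) (N : Module.End K A) (S : Module.End K M) : Prop :=
  IsRotaBaxter mul l r T ∧
  IsNijenhuisStructure mul l r N S ∧
  (∀ m : M, N (T m) = T (S m)) ∧
  (∀ m n : M, starQ l r (fun m => N (T m)) m n = starST l r T S m n)

/-- for an `ON`-structure `(T, N, S)`, the composition `N ∘ T` is a
Rota–Baxter operator on `(A, ·)` with respect to the bimodule `(M, l, r)`. -/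
theorem ON_structure_NT_rotaBaxter {K A M : Type*} [Field K]
    [AddCommGroup A] [Module K A] [AddCommGroup M] [Module K M]
    (mul : A →ₗ[K] A →ₗ[K] A) (hA : AntiFlexible fun a b => mul a b)
    (l r : A →ₗ[K] Module.End K M) (hbim : IsBimodule mul l r)
    (T : M →ₗ[K] A) (N : Module.End K A) (S : Module.End K M)
    (hON : IsONStructure mul l r T N S) :
    ∀ m n : M,
      mul (N (T m)) (N (T n)) = N (T (l (N (T m)) n + r (N (T n)) m)) := by
  intro m n
  obtain ⟨hT, ⟨hN, -, -⟩, hNT, hstar⟩ := hON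
  have h := hstar m n
  simp only [starST, starQ] at h
  rw [h]
  refine (hN (T m) (T n)).trans ?_
  have hT' : ∀ m n : M, mul (T m) (T n) = T (l (T m) n + r (T n) m) := hT
  simp only [hNT, hT', map_add, map_sub]
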